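/- Let p be an odd prime and let a ∈ ℚ_p with |a|_p > 1. Define f : ℤ_p → ℚ_p by f(t) := ζ_{p,E}(t,a) − ⟨a⟩^{1−t}. Then for every n ∈ ℕ and every s ∈ ℤ_p, the series Σ_{k=0}^∞ (n^k/k!)·D^k f(s) converges in ℚ_p and its sum equals f(s+n), where D^k f denotes the k-th iterated derivative of f within ℤ_p (with D^0 f = f). -/

import Mathlib

open Filter Topology

noncomputable def teich (p : ℕ) [Fact p.Prime] (u : ℚ_[p]) : ℚ_[p] :=
  limUnder atTop fun n : ℕ => u ^ p ^ n

noncomputable def omegaV (p : ℕ) [Fact p.Prime] (a : ℚ_[p]) : ℚ_[p] :=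
  (p : ℚ_[p]) ^ a.valuation * teich p (a * (p : ℚ_[p]) ^ (-a.valuation))

noncomputable def proj (p : ℕ) [Fact p.Prime] (a : ℚ_[p]) : ℚ_[p] :=
  a / omegaV p a

noncomputable def binom (p : ℕ) [Fact p.Prime] (s : ℚ_[p]) (n : ℕ) : ℚ_[p] :=
  (∏ j ∈ Finset.range n, (s - (j : ℚ_[p]))) / (n.factorial : ℚ_[p])

noncomputable def hpow (p : ℕ) [Fact p.Prime] (a s : ℚ_[p]) : ℚ_[p] :=
  ∑' n : ℕ, binom p s n * (proj p a - 1) ^ n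

noncomputable def zetaE (p : ℕ) [Fact p.Prime] (s a : ℚ_[p]) : ℚ_[p] :=
  limUnder atTop fun r : ℕ =>
    ∑ k ∈ Finset.range (p ^ r), (-1 : ℚ_[p]) ^ k * hpow p ((k : ℚ_[p]) + a) (1 - s)

noncomputable def coeffT (p : ℕ) [Fact p.Prime] (s a : ℚ_[p]) (n : ℕ) : ℚ_[p] :=
  (∏ j ∈ Finset.Icc 1 (n - 1), (s - 1 + (j : ℚ_[p]))) /
    ((n.factorial : ℚ_[p]) * omegaV p a ^ n)

/-- The closed unit ball `ℤ_p` regarded as a subset of `ℚ_p`. -/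
def Zball (p : ℕ) [Fact p.Prime] : Set ℚ_[p] := {x : ℚ_[p] | ‖x‖ ≤ 1}

open Polynomial

section StrictlyAnalytic

variable {p : ℕ} [Fact p.Prime]

theorem isOpen_Zball : IsOpen (Zball p) := by
  have h : Zball p = Metric.closedBall (0 : ℚ_[p]) 1 := by
    ext x; simp [Zball]
  rw [h]
  exact IsUltrametricDist.isOpen_closedBall 0 one_ne_zero

theorem summable_mul_padicInt {e : ℕ → ℚ_[p]} (he : Summable fun n => ‖e n‖) (w : ℕ → ℤ_[p]) :
    Summable fun n => e n * (w n : ℚ_[p]) := by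
  refine Summable.of_norm_bounded he fun n => ?_
  rw [norm_mul]
  exact mul_le_of_le_one_right (norm_nonneg _) (w n).norm_le_one

theorem hasDerivWithinAt_of_eq_tsum {e : ℕ → ℚ_[p]} (he : Summable fun n => ‖e n‖)
    (Q : ℕ → ℤ_[p][X]) {f : ℚ_[p] → ℚ_[p]}
    (hf : ∀ t : ℤ_[p], f t = ∑' n, e n * ((Q n).eval t : ℤ_[p])) (s : ℤ_[p]) :
    HasDerivWithinAt f (∑' n, e n * (((Q n).derivative.eval s : ℤ_[p]) : ℚ_[p])) (Zball p) s := by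
  rw [hasDerivWithinAt_iff_isLittleO]
  refine Asymptotics.IsBigO.trans_isLittleO (g := fun x => ‖x - (s : ℚ_[p])‖ ^ 2) ?_
    ((Asymptotics.isLittleO_pow_sub_sub (s : ℚ_[p]) one_lt_two).mono nhdsWithin_le_nhds)
  refine Asymptotics.IsBigO.of_bound (∑' n, ‖e n‖) ?_
  filter_upwards [self_mem_nhdsWithin] with x hx
  obtain ⟨h, rfl⟩ : ∃ h : ℤ_[p], x = (s + h : ℤ_[p]) :=
    ⟨⟨x, hx⟩ - s, congrArg Subtype.val (add_sub_cancel s (⟨x, hx⟩ : ℤ_[p])).symm⟩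
  let w : ℕ → ℤ_[p] := fun n => ((Q n).binomExpansion s h).1
  have hw (n : ℕ) : (Q n).eval (s + h) = (Q n).eval s + (Q n).derivative.eval s * h + w n * h ^ 2 :=
    ((Q n).binomExpansion s h).2
  have key : f ((s + h : ℤ_[p]) : ℚ_[p]) - f s -
      (((s + h : ℤ_[p]) : ℚ_[p]) - s) • (∑' n, e n * (((Q n).derivative.eval s : ℤ_[p]) : ℚ_[p])) =
      (∑' n, e n * (w n : ℚ_[p])) * (h : ℚ_[p]) ^ 2 := by
    rw [hf, hf, smul_eq_mul, ← tsum_mul_left, ← tsum_mul_right,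
      ← (summable_mul_padicInt he _).tsum_sub (summable_mul_padicInt he _),
      ← ((summable_mul_padicInt he _).sub (summable_mul_padicInt he _)).tsum_sub
        ((summable_mul_padicInt he _).mul_left _)]
    refine tsum_congr fun n => ?_
    rw [hw]
    push_cast
    ring
  rw [key, norm_mul]
  have hsub : ((s + h : ℤ_[p]) : ℚ_[p]) - s = h := by push_cast; ring
  rw [hsub, norm_pow, norm_pow, norm_norm]
  refine mul_le_mul_of_nonneg_right ?_ (by positivity)
  refine tsum_of_norm_bounded he.hasSum fun n => ?_
  rw [norm_mul]
  exact mul_le_of_le_one_right (norm_nonneg _) (w n).norm_le_one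

theorem iteratedDerivWithin_eq_tsum {e : ℕ → ℚ_[p]} (he : Summable fun n => ‖e n‖)
    (Q : ℕ → ℤ_[p][X]) {f : ℚ_[p] → ℚ_[p]}
    (hf : ∀ t : ℤ_[p], f t = ∑' n, e n * ((Q n).eval t : ℤ_[p])) (k : ℕ) (s : ℤ_[p]) :
    iteratedDerivWithin k f (Zball p) s =
      ∑' n, e n * (((derivative^[k] (Q n)).eval s : ℤ_[p]) : ℚ_[p]) := by
  induction k generalizing s with
  | zero => simp [hf]
  | succ k ih =>
    rw [iteratedDerivWithin_succ]
    simp only [Function.iterate_succ_apply']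
    exact (hasDerivWithinAt_of_eq_tsum he _ ih s).derivWithin
      (isOpen_Zball.uniqueDiffWithinAt s.norm_le_one)

/-- Taylor expansion of a rapidly convergent series of integral polynomials. -/
theorem hasSum_taylor_of_eq_tsum {e : ℕ → ℚ_[p]} (he : Summable fun n : ℕ => ((n : ℝ) + 1) * ‖e n‖)
    (Q : ℕ → ℤ_[p][X]) (hQ : ∀ n, (Q n).natDegree ≤ n) {f : ℚ_[p] → ℚ_[p]}
    (hf : ∀ t : ℤ_[p], f t = ∑' n, e n * ((Q n).eval t : ℤ_[p])) (s h : ℤ_[p]) :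
    HasSum (fun k : ℕ => ((h : ℚ_[p]) ^ k / (k.factorial : ℚ_[p])) *
      iteratedDerivWithin k f (Zball p) s) (f (s + h)) := by
  have he' : Summable fun n => ‖e n‖ := by
    refine Summable.of_nonneg_of_le (fun n => norm_nonneg _) (fun n => ?_) he
    exact le_mul_of_one_le_left (norm_nonneg _) (by simp)
  let F : ℕ × ℕ → ℚ_[p] := fun q =>
    e q.1 * (((hasseDeriv q.2 (Q q.1)).eval s * h ^ q.2 : ℤ_[p]) : ℚ_[p])
  have hzero (n k : ℕ) (hk : k ∉ Finset.range (n + 1)) : F (n, k) = 0 := by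
    have : hasseDeriv k (Q n) = 0 :=
      hasseDeriv_eq_zero_of_lt_natDegree _ _ ((hQ n).trans_lt (by simpa using hk))
    simp [F, this]
  have hrow (n : ℕ) : HasSum (fun k => F (n, k)) (e n * ((Q n).eval (s + h) : ℤ_[p])) := by
    have h1 : HasSum (fun k => F (n, k)) (∑ k ∈ Finset.range (n + 1), F (n, k)) :=
      hasSum_sum_of_ne_finset_zero (hzero n)
    convert h1 using 1
    rw [add_comm, ← taylor_eval, eval_eq_sum_range' (n := n + 1)
      (by rw [natDegree_taylor]; exact Nat.lt_succ_of_le (hQ n))]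
    simp [F, taylor_coeff, Finset.mul_sum]
  have hF (n k : ℕ) : ‖F (n, k)‖ ≤ ‖e n‖ := by
    rw [norm_mul]
    exact mul_le_of_le_one_right (norm_nonneg _) (PadicInt.norm_le_one _)
  have hsum : Summable F := by
    refine Summable.of_norm ?_
    rw [summable_prod_of_nonneg fun _ => norm_nonneg _]
    refine ⟨fun n => summable_of_ne_finset_zero (s := Finset.range (n + 1))
      fun k hk => by rw [hzero n k hk, norm_zero], ?_⟩
    refine Summable.of_nonneg_of_le (fun n => tsum_nonneg fun _ => norm_nonneg _) (fun n => ?_) he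
    rw [tsum_eq_sum (s := Finset.range (n + 1)) fun k hk => by rw [hzero n k hk, norm_zero]]
    refine (Finset.sum_le_sum fun k _ => hF n k).trans ?_
    simp
  have htot : f (s + h) = ∑' q, F q := by
    rw [← PadicInt.coe_add, hf]
    exact (hsum.hasSum.prod_fiberwise hrow).tsum_eq
  rw [htot]
  have hswap : HasSum (F ∘ Prod.swap) (∑' q, F q) :=
    (Equiv.prodComm ℕ ℕ).hasSum_iff.2 hsum.hasSum
  refine hswap.prod_fiberwise fun k => ?_
  rw [iteratedDerivWithin_eq_tsum he' Q hf, ← tsum_mul_left]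
  have hfac : (k.factorial : ℚ_[p]) ≠ 0 := by exact_mod_cast k.factorial_ne_zero
  have hterm (n : ℕ) : (F ∘ Prod.swap) (k, n) = (h : ℚ_[p]) ^ k / (k.factorial : ℚ_[p]) *
      (e n * (((derivative^[k] (Q n)).eval s : ℤ_[p]) : ℚ_[p])) := by
    rw [← factorial_smul_hasseDeriv, LinearMap.smul_apply, eval_smul, nsmul_eq_mul]
    simp only [F, Function.comp, Prod.swap]
    push_cast
    field_simp
  simp only [← hterm]
  exact (hswap.summable.prod_factor k).hasSum

end StrictlyAnalytic

section Teichmuller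

variable {p : ℕ} [hp : Fact p.Prime]

theorem PadicInt.natCast_dvd_pow_sub_self (u : ℤ_[p]) : (p : ℤ_[p]) ∣ u ^ p - u := by
  rw [← Ideal.mem_span_singleton, ← PadicInt.maximalIdeal_eq_span_p, ← PadicInt.ker_toZMod,
    RingHom.mem_ker, map_sub, map_pow, ZMod.pow_card, sub_self]

theorem PadicInt.norm_le_inv_iff_dvd (u : ℤ_[p]) : ‖u‖ ≤ (p : ℝ)⁻¹ ↔ (p : ℤ_[p]) ∣ u := by
  have := PadicInt.norm_le_pow_iff_mem_span_pow u 1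
  simpa [Ideal.mem_span_singleton] using this

theorem PadicInt.norm_le_inv_pow_of_dvd {u : ℤ_[p]} {n : ℕ} (h : (p : ℤ_[p]) ^ n ∣ u) :
    ‖u‖ ≤ (p : ℝ)⁻¹ ^ n := by
  have := (PadicInt.norm_le_pow_iff_mem_span_pow u n).2 (Ideal.mem_span_singleton.2 h)
  simpa using this

theorem inv_prime_lt_one : (p : ℝ)⁻¹ < 1 :=
  inv_lt_one_of_one_lt₀ (by exact_mod_cast hp.out.one_lt)

theorem tendsto_teich (u : ℤ_[p]) :
    Tendsto (fun n : ℕ => (u : ℚ_[p]) ^ p ^ n) atTop (𝓝 (teich p u)) := by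
  refine CauchySeq.tendsto_limUnder
    (cauchySeq_of_le_geometric (p : ℝ)⁻¹ 1 inv_prime_lt_one fun n => ?_)
  have h := (pow_dvd_pow (p : ℤ_[p]) n.le_succ).trans
    (dvd_sub_pow_of_dvd_sub u.natCast_dvd_pow_sub_self n)
  have h' := PadicInt.norm_le_inv_pow_of_dvd h
  rw [dist_comm, dist_eq_norm, one_mul]
  rw [← pow_mul, ← pow_succ'] at h'
  simpa [PadicInt.norm_def] using h'

theorem norm_teich_sub_le (u : ℤ_[p]) : ‖teich p u - u‖ ≤ (p : ℝ)⁻¹ := by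
  refine le_of_tendsto ((tendsto_teich u).sub_const (u : ℚ_[p])).norm (Eventually.of_forall ?_)
  intro n
  have h : (p : ℤ_[p]) ∣ u ^ p ^ n - u := by
    induction n with
    | zero => simp
    | succ n ih =>
      have := (u ^ p ^ n).natCast_dvd_pow_sub_self.add ih
      rwa [← pow_mul, ← pow_succ, sub_add_sub_cancel] at this
  simpa [PadicInt.norm_def] using (PadicInt.norm_le_inv_iff_dvd _).2 h

theorem teich_eq_of_norm_sub_le {u v : ℤ_[p]} (h : ‖u - v‖ ≤ (p : ℝ)⁻¹) :
    teich p u = teich p v := by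
  rw [PadicInt.norm_le_inv_iff_dvd] at h
  have h0 : Tendsto (fun n : ℕ => (u : ℚ_[p]) ^ p ^ n - (v : ℚ_[p]) ^ p ^ n) atTop (𝓝 0) := by
    refine squeeze_zero_norm (fun n => ?_)
      (tendsto_pow_atTop_nhds_zero_of_lt_one (r := (p : ℝ)⁻¹) (by positivity) inv_prime_lt_one)
    have h' := PadicInt.norm_le_inv_pow_of_dvd
      ((pow_dvd_pow (p : ℤ_[p]) n.le_succ).trans (dvd_sub_pow_of_dvd_sub h n))
    simpa [PadicInt.norm_def] using h'
  exact sub_eq_zero.1 (tendsto_nhds_unique ((tendsto_teich u).sub (tendsto_teich v)) h0)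

theorem norm_teich_eq_one {u : ℤ_[p]} (hu : ‖u‖ = 1) : ‖teich p u‖ = 1 := by
  have h : ‖teich p u - u‖ < ‖(u : ℚ_[p])‖ := by
    rw [PadicInt.padic_norm_e_of_padicInt, hu]
    exact (norm_teich_sub_le u).trans_lt inv_prime_lt_one
  have := IsUltrametricDist.norm_add_eq_max_of_norm_ne_norm h.ne
  rw [sub_add_cancel, max_eq_right h.le, PadicInt.padic_norm_e_of_padicInt, hu] at this
  exact this

theorem norm_mul_zpow_neg_valuation {a : ℚ_[p]} (ha : a ≠ 0) :
    ‖a * (p : ℚ_[p]) ^ (-a.valuation)‖ = 1 := by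
  have hp0 : (p : ℝ) ≠ 0 := by exact_mod_cast hp.out.ne_zero
  rw [norm_mul, Padic.norm_eq_zpow_neg_valuation ha, Padic.norm_p_zpow, neg_neg,
    ← zpow_add₀ hp0, neg_add_cancel, zpow_zero]

theorem norm_omegaV {a : ℚ_[p]} (ha : a ≠ 0) : ‖omegaV p a‖ = ‖a‖ := by
  let u : ℤ_[p] := ⟨_, (norm_mul_zpow_neg_valuation ha).le⟩
  have hu : ‖teich p (a * (p : ℚ_[p]) ^ (-a.valuation))‖ = 1 :=
    norm_teich_eq_one (u := u) (norm_mul_zpow_neg_valuation ha)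
  rw [omegaV, norm_mul, hu, mul_one, Padic.norm_p_zpow, Padic.norm_eq_zpow_neg_valuation ha]

theorem norm_proj_sub_one_le {a : ℚ_[p]} (ha : a ≠ 0) : ‖proj p a - 1‖ ≤ (p : ℝ)⁻¹ := by
  let u : ℤ_[p] := ⟨_, (norm_mul_zpow_neg_valuation ha).le⟩
  have hT : ‖teich p u - u‖ ≤ (p : ℝ)⁻¹ := norm_teich_sub_le u
  have hu : ‖teich p u‖ = 1 := norm_teich_eq_one (u := u) (norm_mul_zpow_neg_valuation ha)
  have hT0 : teich p u ≠ 0 := norm_ne_zero_iff.1 (by rw [hu]; exact one_ne_zero)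
  have hp0 : (p : ℚ_[p]) ^ a.valuation ≠ 0 :=
    zpow_ne_zero _ (by exact_mod_cast hp.out.ne_zero)
  have hq : proj p a - 1 = (u - teich p u) / teich p u := by
    change a / ((p : ℚ_[p]) ^ a.valuation * teich p u) - 1 =
      (a * (p : ℚ_[p]) ^ (-a.valuation) - teich p u) / teich p u
    rw [zpow_neg]
    field_simp
  rw [hq, norm_div, hu, div_one, norm_sub_rev]
  exact hT

theorem inv_norm_le_inv_prime {a : ℚ_[p]} (ha : 1 < ‖a‖) : ‖a‖⁻¹ ≤ (p : ℝ)⁻¹ := by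
  have ha0 : a ≠ 0 := norm_pos_iff.1 (one_pos.trans ha)
  have hp1 : (1 : ℝ) < p := by exact_mod_cast hp.out.one_lt
  refine inv_anti₀ (by positivity) ?_
  rw [Padic.norm_eq_zpow_neg_valuation ha0] at ha ⊢
  have h : (0 : ℤ) < -a.valuation := by
    rwa [← zpow_lt_zpow_iff_right₀ hp1, zpow_zero]
  calc (p : ℝ) = (p : ℝ) ^ (1 : ℤ) := (zpow_one _).symm
    _ ≤ _ := zpow_le_zpow_right₀ hp1.le h

theorem omegaV_natCast_add {a : ℚ_[p]} (ha : 1 < ‖a‖) (k : ℕ) :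
    omegaV p ((k : ℚ_[p]) + a) = omegaV p a := by
  have ha0 : a ≠ 0 := norm_pos_iff.1 (one_pos.trans ha)
  have hk : ‖(k : ℚ_[p])‖ ≤ 1 := IsUltrametricDist.norm_natCast_le_one ℚ_[p] k
  have hn : ‖(k : ℚ_[p]) + a‖ = ‖a‖ := by
    rw [IsUltrametricDist.norm_add_eq_max_of_norm_ne_norm (hk.trans_lt ha).ne,
      max_eq_right (hk.trans ha.le)]
  have hka0 : (k : ℚ_[p]) + a ≠ 0 := norm_ne_zero_iff.1 (by rw [hn]; positivity)
  have hp1 : (1 : ℝ) < p := by exact_mod_cast hp.out.one_lt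
  have hv : ((k : ℚ_[p]) + a).valuation = a.valuation := by
    rw [Padic.norm_eq_zpow_neg_valuation ha0, Padic.norm_eq_zpow_neg_valuation hka0] at hn
    exact neg_injective (zpow_right_injective₀ (by positivity) hp1.ne' hn)
  have h1 := (norm_mul_zpow_neg_valuation hka0).le
  rw [hv] at h1
  rw [omegaV, omegaV, hv]
  congr 1
  refine teich_eq_of_norm_sub_le (u := ⟨_, h1⟩) (v := ⟨_, (norm_mul_zpow_neg_valuation ha0).le⟩) ?_
  change ‖((k : ℚ_[p]) + a) * (p : ℚ_[p]) ^ (-a.valuation) - a * (p : ℚ_[p]) ^ (-a.valuation)‖ ≤ _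
  rw [← sub_mul, add_sub_cancel_right, norm_mul, Padic.norm_p_zpow, neg_neg]
  have h2 := inv_norm_le_inv_prime ha
  rw [Padic.norm_eq_zpow_neg_valuation ha0, zpow_neg, inv_inv] at h2
  exact (mul_le_of_le_one_left (by positivity) hk).trans h2

theorem proj_natCast_add {a : ℚ_[p]} (ha : 1 < ‖a‖) (k : ℕ) :
    proj p ((k : ℚ_[p]) + a) - 1 = (proj p a - 1) + k * (omegaV p a)⁻¹ := by
  rw [proj, proj, omegaV_natCast_add ha]
  ring

end Teichmuller

section Series

variable {p : ℕ} [hp : Fact p.Prime]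

/-- The polynomial `(1 - X)(-X)(-1 - X)⋯`, with `n` factors. -/
noncomputable def reflectedDescPochhammer (p : ℕ) [Fact p.Prime] (n : ℕ) : ℤ_[p][X] :=
  ∏ j ∈ Finset.range n, (C (1 - (j : ℤ_[p])) - X)

theorem natDegree_reflectedDescPochhammer_le (n : ℕ) :
    (reflectedDescPochhammer p n).natDegree ≤ n := by
  refine (natDegree_prod_le _ _).trans ?_
  refine (Finset.sum_le_card_nsmul _ _ 1 fun j _ => ?_).trans (by simp)
  exact (natDegree_sub_le _ _).trans (by rw [natDegree_C, natDegree_X, zero_max])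

theorem binom_one_sub (t : ℤ_[p]) (n : ℕ) (z : ℚ_[p]) :
    binom p (1 - (t : ℚ_[p])) n * z ^ n =
      z ^ n / (n.factorial : ℚ_[p]) * ((reflectedDescPochhammer p n).eval t : ℤ_[p]) := by
  have h : (((reflectedDescPochhammer p n).eval t : ℤ_[p]) : ℚ_[p]) =
      ∏ j ∈ Finset.range n, (1 - (t : ℚ_[p]) - (j : ℚ_[p])) := by
    rw [reflectedDescPochhammer, eval_prod]
    refine (map_prod PadicInt.Coe.ringHom _ _).trans (Finset.prod_congr rfl fun j _ => ?_)
    rw [eval_sub, eval_C, eval_X]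
    change ((1 - (j : ℤ_[p]) - t : ℤ_[p]) : ℚ_[p]) = _
    push_cast
    ring
  rw [h, binom]
  ring

theorem norm_pow_div_factorial_le (hodd : p ≠ 2) {z : ℚ_[p]} (hz : ‖z‖ ≤ (p : ℝ)⁻¹) (n : ℕ) :
    ‖z ^ n / (n.factorial : ℚ_[p])‖ ≤ √(p : ℝ)⁻¹ ^ n := by
  have hp3 : 2 ≤ p - 1 := by
    have := hp.out.two_le
    omega
  have hv : 2 * padicValNat p n.factorial ≤ n :=
    (Nat.mul_le_mul_right _ hp3).trans
      ((sub_one_mul_padicValNat_factorial (p := p) n).le.trans (Nat.sub_le _ _))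
  have hp0 : (0 : ℝ) < (p : ℝ)⁻¹ := inv_pos.2 (by exact_mod_cast hp.out.pos)
  have hfac : ‖(n.factorial : ℚ_[p])‖ = (p : ℝ)⁻¹ ^ padicValNat p n.factorial := by
    rw [Padic.norm_eq_zpow_neg_valuation (by exact_mod_cast n.factorial_ne_zero),
      Padic.valuation_natCast, zpow_neg, zpow_natCast, inv_pow]
  have hr1 : √(p : ℝ)⁻¹ ≤ 1 := Real.sqrt_le_one.2 inv_prime_lt_one.le
  have hsq : (p : ℝ)⁻¹ = √(p : ℝ)⁻¹ ^ 2 := (Real.sq_sqrt hp0.le).symm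
  rw [norm_div, norm_pow, hfac, div_le_iff₀ (by positivity)]
  refine (pow_le_pow_left₀ (norm_nonneg _) hz n).trans ?_
  conv_lhs => rw [hsq]
  conv_rhs => rw [show (p : ℝ)⁻¹ ^ padicValNat p n.factorial =
    √(p : ℝ)⁻¹ ^ (2 * padicValNat p n.factorial) by rw [pow_mul, ← hsq]]
  rw [← pow_mul, ← pow_add]
  exact pow_le_pow_of_le_one (Real.sqrt_nonneg _) hr1 (by omega)

theorem sum_range_mul_alternating {R : Type*} [CommRing R] {m : ℕ} (hm : Odd m) (g : ℕ → R)
    (l : ℕ) :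
    ∑ k ∈ Finset.range (m * l), (-1) ^ k * g k =
      ∑ j ∈ Finset.range l, (-1) ^ j * ∑ i ∈ Finset.range m, (-1) ^ i * g (i + m * j) := by
  induction l with
  | zero => simp
  | succ l ih =>
    rw [Nat.mul_succ, Finset.sum_range_add, ih, Finset.sum_range_succ, Finset.mul_sum]
    congr 1
    refine Finset.sum_congr rfl fun i _ => ?_
    rw [pow_add, pow_mul, hm.neg_one_pow, add_comm i]
    ring

/-- Convergence of the fermionic Riemann sums of a Lipschitz function. -/
theorem exists_tendsto_alternating_sum (hodd : p ≠ 2) {g : ℕ → ℚ_[p]} {c : ℝ}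
    (hg : ∀ k l : ℕ, ‖g (k + l) - g k‖ ≤ c * ‖(l : ℚ_[p])‖) :
    ∃ L, Tendsto (fun r : ℕ => ∑ k ∈ Finset.range (p ^ r), (-1 : ℚ_[p]) ^ k * g k)
      atTop (𝓝 L) := by
  have hpo : Odd p := hp.out.odd_of_ne_two hodd
  have hc : 0 ≤ c := by simpa using (norm_nonneg _).trans (hg 0 1)
  refine cauchySeq_tendsto_of_complete
    (cauchySeq_of_le_geometric (p : ℝ)⁻¹ c inv_prime_lt_one fun r => ?_)
  have hone : ∑ j ∈ Finset.range p, (-1 : ℚ_[p]) ^ j = 1 := by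
    rw [neg_one_geom_sum, if_neg (Nat.not_even_iff_odd.2 hpo)]
  rw [dist_comm, dist_eq_norm, pow_succ, sum_range_mul_alternating hpo.pow]
  have hS : ∑ k ∈ Finset.range (p ^ r), (-1 : ℚ_[p]) ^ k * g k = ∑ j ∈ Finset.range p,
      (-1 : ℚ_[p]) ^ j * ∑ k ∈ Finset.range (p ^ r), (-1 : ℚ_[p]) ^ k * g k := by
    rw [← Finset.sum_mul, hone, one_mul]
  rw [hS, ← Finset.sum_sub_distrib]
  have hnn : 0 ≤ c * (p : ℝ)⁻¹ ^ r := by positivity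
  refine IsUltrametricDist.norm_sum_le_of_forall_le_of_nonneg hnn fun j _ => ?_
  rw [← mul_sub, ← Finset.sum_sub_distrib, norm_mul, norm_pow, norm_neg, norm_one, one_pow, one_mul]
  refine IsUltrametricDist.norm_sum_le_of_forall_le_of_nonneg hnn fun i _ => ?_
  rw [← mul_sub, norm_mul, norm_pow, norm_neg, norm_one, one_pow, one_mul]
  refine (hg _ _).trans (mul_le_mul_of_nonneg_left ?_ hc)
  rw [Nat.cast_mul, Nat.cast_pow, norm_mul, norm_pow, Padic.norm_p]
  exact mul_le_of_le_one_right (by positivity) (IsUltrametricDist.norm_natCast_le_one ℚ_[p] j)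

theorem norm_pow_div_factorial_sub_le (x y : ℤ_[p]) (n k l : ℕ) :
    ‖((x : ℚ_[p]) + (k + l : ℕ) * y) ^ n / (n.factorial : ℚ_[p]) -
      ((x : ℚ_[p]) + k * y) ^ n / (n.factorial : ℚ_[p])‖ ≤
      ‖(n.factorial : ℚ_[p])‖⁻¹ * ‖(l : ℚ_[p])‖ := by
  obtain ⟨w, hw⟩ := sub_dvd_pow_sub_pow (x + (k + l : ℕ) * y) (x + k * y) n
  have hw' : ((x : ℚ_[p]) + (k + l : ℕ) * y) ^ n - ((x : ℚ_[p]) + k * y) ^ n =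
      l * ((y * w : ℤ_[p]) : ℚ_[p]) := by
    have h := congrArg (fun z : ℤ_[p] => (z : ℚ_[p])) hw
    push_cast at h ⊢
    rw [h]
    ring
  rw [← sub_div, hw', norm_div, norm_mul, div_eq_inv_mul]
  refine mul_le_mul_of_nonneg_left ?_ (by positivity)
  exact mul_le_of_le_one_right (norm_nonneg _) (PadicInt.norm_le_one _)

theorem summable_succ_mul_pow_sqrt :
    Summable fun n : ℕ => ((n : ℝ) + 1) * √(p : ℝ)⁻¹ ^ n := by
  have hp0 : (0 : ℝ) ≤ (p : ℝ)⁻¹ := by positivity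
  have hr : ‖√(p : ℝ)⁻¹‖ < 1 := by
    rw [Real.norm_of_nonneg (Real.sqrt_nonneg _), Real.sqrt_lt' one_pos, one_pow]
    exact inv_prime_lt_one
  have h1 := summable_pow_mul_geometric_of_norm_lt_one 1 hr
  have h0 := summable_geometric_of_norm_lt_one hr
  simpa [add_mul] using h1.add h0

theorem summable_pow_sqrt : Summable fun n : ℕ => √(p : ℝ)⁻¹ ^ n :=
  Summable.of_nonneg_of_le (fun n => by positivity)
    (fun n => le_mul_of_one_le_left (by positivity) (by simp)) (summable_succ_mul_pow_sqrt (p := p))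

theorem hpow_one_sub (a : ℚ_[p]) (t : ℤ_[p]) :
    hpow p a (1 - (t : ℚ_[p])) = ∑' n, (proj p a - 1) ^ n / (n.factorial : ℚ_[p]) *
      ((reflectedDescPochhammer p n).eval t : ℤ_[p]) := by
  rw [hpow]
  exact tsum_congr fun n => binom_one_sub t n _

theorem exists_zetaE_eq_tsum (hodd : p ≠ 2) {a : ℚ_[p]} (ha : 1 < ‖a‖) :
    ∃ b : ℕ → ℚ_[p], (∀ n, ‖b n‖ ≤ √(p : ℝ)⁻¹ ^ n) ∧ ∀ t : ℤ_[p],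
      zetaE p t a = ∑' n, b n * ((reflectedDescPochhammer p n).eval t : ℤ_[p]) := by
  have ha0 : a ≠ 0 := norm_pos_iff.1 (one_pos.trans ha)
  have hx := norm_proj_sub_one_le ha0
  have hy : ‖(omegaV p a)⁻¹‖ ≤ (p : ℝ)⁻¹ := by
    rw [norm_inv, norm_omegaV ha0]
    exact inv_norm_le_inv_prime ha
  obtain ⟨x, hxe⟩ : ∃ x : ℤ_[p], (x : ℚ_[p]) = proj p a - 1 :=
    ⟨⟨_, hx.trans inv_prime_lt_one.le⟩, rfl⟩
  obtain ⟨y, hye⟩ : ∃ y : ℤ_[p], (y : ℚ_[p]) = (omegaV p a)⁻¹ :=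
    ⟨⟨_, hy.trans inv_prime_lt_one.le⟩, rfl⟩
  rw [← hxe] at hx
  rw [← hye] at hy
  have hz (k : ℕ) : proj p ((k : ℚ_[p]) + a) - 1 = x + k * y := by
    rw [proj_natCast_add ha, hxe, hye]
  have hzn (k : ℕ) : ‖(x : ℚ_[p]) + k * y‖ ≤ (p : ℝ)⁻¹ := by
    refine (IsUltrametricDist.norm_add_le_max _ _).trans (max_le hx ?_)
    rw [norm_mul]
    exact (mul_le_of_le_one_left (norm_nonneg _)
      (IsUltrametricDist.norm_natCast_le_one ℚ_[p] k)).trans hy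
  let B : ℕ → ℕ → ℚ_[p] := fun r n => ∑ k ∈ Finset.range (p ^ r),
    (-1 : ℚ_[p]) ^ k * (((x : ℚ_[p]) + k * y) ^ n / (n.factorial : ℚ_[p]))
  have hB (r n : ℕ) : ‖B r n‖ ≤ √(p : ℝ)⁻¹ ^ n := by
    refine IsUltrametricDist.norm_sum_le_of_forall_le_of_nonneg (by positivity) fun k _ => ?_
    rw [norm_mul, norm_pow, norm_neg, norm_one, one_pow, one_mul]
    exact norm_pow_div_factorial_le hodd (hzn k) n
  have hlim (n : ℕ) : ∃ L, Tendsto (fun r => B r n) atTop (𝓝 L) :=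
    exists_tendsto_alternating_sum hodd (norm_pow_div_factorial_sub_le x y n)
  choose b hb using hlim
  refine ⟨b, fun n => le_of_tendsto (hb n).norm (Eventually.of_forall fun r => hB r n), fun t => ?_⟩
  have hsumm (k : ℕ) : Summable fun n => ((x : ℚ_[p]) + k * y) ^ n / (n.factorial : ℚ_[p]) *
      ((reflectedDescPochhammer p n).eval t : ℤ_[p]) :=
    summable_mul_padicInt (Summable.of_nonneg_of_le (fun _ => norm_nonneg _)
      (norm_pow_div_factorial_le hodd (hzn k)) summable_pow_sqrt) _
  have hS (r : ℕ) : ∑ k ∈ Finset.range (p ^ r),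
      (-1 : ℚ_[p]) ^ k * hpow p ((k : ℚ_[p]) + a) (1 - (t : ℚ_[p])) =
      ∑' n, B r n * ((reflectedDescPochhammer p n).eval t : ℤ_[p]) := by
    simp only [hpow_one_sub, hz, ← tsum_mul_left]
    rw [← Summable.tsum_finsetSum fun k _ => (hsumm k).mul_left _]
    refine tsum_congr fun n => ?_
    rw [Finset.sum_mul]
    exact Finset.sum_congr rfl fun k _ => (mul_assoc _ _ _).symm
  rw [zetaE]
  simp only [hS]
  refine Tendsto.limUnder_eq (tendsto_tsum_of_dominated_convergence (summable_pow_sqrt (p := p))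
    (fun n => (hb n).mul_const _) (Eventually.of_forall fun r n => ?_))
  rw [norm_mul]
  exact (mul_le_of_le_one_right (norm_nonneg _) (PadicInt.norm_le_one _)).trans (hB r n)

end Series

/-- shift property of `exp_p(nD)`: for an odd prime `p` and `a ∈ ℚ_p` with
`|a|_p > 1`, set `f(t) = ζ_{p,E}(t,a) - ⟨a⟩^{1-t}`.  Then for every `n ∈ ℕ` and `s ∈ ℤ_p`
the series `∑_{k≥0} (n^k/k!) D^k f(s)` converges in `ℚ_p` with sum `f(s+n)`, where `D^k`
denotes the k-th iterated derivative within `ℤ_p` (and `D^0 f = f`). -/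
theorem padic_exp_shift_operator
    (p : ℕ) [Fact p.Prime] (hodd : p ≠ 2)
    (a : ℚ_[p]) (ha : 1 < ‖a‖)
    (f : ℚ_[p] → ℚ_[p]) (hf : ∀ t : ℚ_[p], f t = zetaE p t a - hpow p a (1 - t))
    (n : ℕ) (s : ℚ_[p]) (hs : ‖s‖ ≤ 1) :
    HasSum
      (fun k : ℕ =>
        ((n : ℚ_[p]) ^ k / (k.factorial : ℚ_[p])) * iteratedDerivWithin k f (Zball p) s)
      (f (s + (n : ℚ_[p]))) := by
  obtain ⟨b, hb, hzeta⟩ := exists_zetaE_eq_tsum hodd ha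
  have hx := norm_proj_sub_one_le (norm_pos_iff.1 (one_pos.trans ha))
  have hc := norm_pow_div_factorial_le hodd hx
  have hsum {c : ℕ → ℚ_[p]} (h : ∀ n, ‖c n‖ ≤ √(p : ℝ)⁻¹ ^ n) : Summable fun n => ‖c n‖ :=
    Summable.of_nonneg_of_le (fun _ => norm_nonneg _) h summable_pow_sqrt
  obtain ⟨s, rfl⟩ : ∃ t : ℤ_[p], (t : ℚ_[p]) = s := ⟨⟨s, hs⟩, rfl⟩
  let e : ℕ → ℚ_[p] := fun m => b m - (proj p a - 1) ^ m / (m.factorial : ℚ_[p])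
  have he : Summable fun m : ℕ => ((m : ℝ) + 1) * ‖e m‖ := by
    refine Summable.of_nonneg_of_le (fun _ => by positivity) (fun m => ?_)
      (summable_succ_mul_pow_sqrt (p := p))
    refine mul_le_mul_of_nonneg_left ?_ (by positivity)
    rw [show e m = b m + -((proj p a - 1) ^ m / (m.factorial : ℚ_[p])) from sub_eq_add_neg _ _]
    exact (IsUltrametricDist.norm_add_le_max _ _).trans
      (max_le (hb m) ((norm_neg _).trans_le (hc m)))
  have hfe (t : ℤ_[p]) : f t = ∑' m, e m * ((reflectedDescPochhammer p m).eval t : ℤ_[p]) := by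
    rw [hf, hzeta, hpow_one_sub,
      ← (summable_mul_padicInt (hsum hb) _).tsum_sub (summable_mul_padicInt (hsum hc) _)]
    exact tsum_congr fun m => (sub_mul _ _ _).symm
  simpa using hasSum_taylor_of_eq_tsum he _ natDegree_reflectedDescPochhammer_le hfe s (n : ℤ_[p])
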